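/- arXiv:2304.03478 — 2 statements merged into one kernel-verified Lean document; each statement's English description precedes it below -/
import Mathlib

section
/- Let n ≥ 1 and τ ≥ 1, and let S be a nonempty set of past-directed unit timelike vectors ν ∈ ℝ^{n+1} (η(ν,ν) = −1, ν₀ < 0) satisfying −ν₀ ≤ τ. For each ν ∈ S define Λ(ν) = {p ∈ ℝ^{n+1} : η(p,p) + η(p,ν)² < 1 and −1 ≤ η(p,ν) ≤ 0} (the set of p whose tangential component relative to ν has squared length less than 1 and whose normal component lies between 0 and 1 in the past direction). Then the Lebesgue measure of ∩_{ν ∈ S} Λ(ν) is at least ω_n / ((n+1) · τ · (τ + √(τ²−1))ⁿ). -/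
open MeasureTheory

/-- The Minkowski inner product on `ℝ^{n,1}`:
`η p q = -p₀q₀ + ∑_{i=1}^n pᵢqᵢ`. -/
noncomputable def minkowski {n : ℕ} (p q : Fin (n + 1) → ℝ) : ℝ :=
  -(p 0 * q 0) + ∑ i : Fin (n + 1), if i = 0 then 0 else p i * q i

/-- `ω_n`, the Lebesgue volume of the unit ball in `ℝⁿ`. -/
noncomputable def unitBallVolume (n : ℕ) : ℝ :=
  (volume (Metric.ball (0 : EuclideanSpace ℝ (Fin n)) 1)).toReal

/-- The Minkowski product split into its time part and its space part. -/
lemma minkowski_eq {n : ℕ} (p q : Fin (n + 1) → ℝ) :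
    minkowski p q = -(p 0 * q 0) + ∑ i : Fin n, p i.succ * q i.succ := by
  simp [minkowski, Fin.sum_univ_succ, Fin.succ_ne_zero]

/-- The estimates on the base of the double cone: here `r = τ - √(τ² - 1)`, `Y` is the squared norm
of a vector in the ball of radius `r`, and `k` its product with the space part of a unit timelike
vector of slope `a`. -/
lemma base_estimates {τ w r a Y k : ℝ} (hw : 0 ≤ w) (hwτ : w ^ 2 = τ ^ 2 - 1)
    (hr : 0 < r) (hrw : r * (τ + w) = 1) (ha : 1 ≤ a) (haτ : a ≤ τ) (hY : Y < r ^ 2)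
    (hY0 : 0 ≤ Y) (hk : k ^ 2 ≤ Y * (a ^ 2 - 1)) :
    0 ≤ a / (2 * τ) - k ∧ a / (2 * τ) - k ≤ 1 ∧
      Y - (1 / (2 * τ)) ^ 2 + (a / (2 * τ) - k) ^ 2 < 1 := by
  have hτ : 0 < τ := by linarith
  have hr' : r = τ - w := by
    have h : (τ - w) * (τ + w) = 1 := by linear_combination -hwτ
    have h' : τ + w ≠ 0 := by positivity
    exact mul_right_cancel₀ h' (hrw.trans h.symm)
  have h2rw : 2 * (r * w) = 1 - r ^ 2 := by subst hr'; linear_combination -hwτ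
  have h2rτ : 2 * (r * τ) = 1 + r ^ 2 := by subst hr'; linear_combination -hwτ
  have ha0 : 0 ≤ a ^ 2 - 1 := by nlinarith
  have hk' : k ^ 2 ≤ r ^ 2 * (a ^ 2 - 1) :=
    hk.trans (mul_le_mul_of_nonneg_right hY.le ha0)
  have hk1 : |k| ≤ r * w := by
    refine abs_le_of_sq_le_sq ?_ (by positivity)
    rw [mul_pow, hwτ]
    exact hk'.trans (by gcongr)
  have hk2 : |k| ≤ a / (2 * τ) := by
    refine abs_le_of_sq_le_sq ?_ (by positivity)
    refine hk'.trans ?_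
    rw [div_pow, le_div_iff₀ (by positivity)]
    have h1 : (a ^ 2 - 1) * τ ^ 2 ≤ a ^ 2 * w ^ 2 := by rw [hwτ]; nlinarith
    have h2 : (2 * (r * w)) ^ 2 ≤ 1 := by
      rw [h2rw]
      have : 0 ≤ 1 - r ^ 2 := by rw [← h2rw]; positivity
      nlinarith [sq_nonneg r]
    calc r ^ 2 * (a ^ 2 - 1) * (2 * τ) ^ 2 = 4 * r ^ 2 * ((a ^ 2 - 1) * τ ^ 2) := by ring
      _ ≤ 4 * r ^ 2 * (a ^ 2 * w ^ 2) := by gcongr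
      _ = a ^ 2 * (2 * (r * w)) ^ 2 := by ring
      _ ≤ a ^ 2 * 1 := by gcongr
      _ = a ^ 2 := mul_one _
  have haτ2 : a / (2 * τ) ≤ 1 / 2 := by
    rw [div_le_div_iff₀ (by positivity) (by positivity)]; linarith
  obtain ⟨hk1l, -⟩ := abs_le.1 hk1
  obtain ⟨-, hk2r⟩ := abs_le.1 hk2
  have hq : a / (2 * τ) - k ≤ 1 - r ^ 2 / 2 := by linarith
  have hq0 : 0 ≤ a / (2 * τ) - k := by linarith
  refine ⟨hq0, by nlinarith [sq_nonneg r], ?_⟩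
  have hsq : (a / (2 * τ) - k) ^ 2 ≤ (1 - r ^ 2 / 2) ^ 2 := by gcongr
  have hr4 : r ^ 4 / 4 ≤ (1 / (2 * τ)) ^ 2 := by
    have hrτ : r ^ 2 ≤ 1 / τ := by
      rw [le_div_iff₀ hτ]
      have : r ≤ 1 := by nlinarith
      have : r * τ ≤ 1 := by nlinarith
      nlinarith
    calc r ^ 4 / 4 = (r ^ 2) ^ 2 / 4 := by ring
      _ ≤ (1 / τ) ^ 2 / 4 := by gcongr
      _ = _ := by ring
  nlinarith

/-- The squared norm of the tangential component is nonnegative. -/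
lemma tangential_nonneg {a t Y k : ℝ} (ha : 1 ≤ a) (hY0 : 0 ≤ Y)
    (hk : k ^ 2 ≤ Y * (a ^ 2 - 1)) : 0 ≤ Y - t ^ 2 + (a * t - k) ^ 2 := by
  rcases ha.eq_or_lt with rfl | ha
  · have : k = 0 := by nlinarith
    subst this
    nlinarith
  · have h : 0 < a ^ 2 - 1 := by nlinarith
    refine nonneg_of_mul_nonneg_right (a := a ^ 2 - 1) ?_ h
    nlinarith [sq_nonneg (a * k - (a ^ 2 - 1) * t)]

/-- Points of the double cone over the ball of radius `r` satisfy the inequalities defining the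
slab of a unit timelike vector of slope `a ≤ τ`. -/
lemma double_cone_estimates {τ w r a s X k : ℝ} (hw : 0 ≤ w) (hwτ : w ^ 2 = τ ^ 2 - 1)
    (hr : 0 < r) (hrw : r * (τ + w) = 1) (ha : 1 ≤ a) (haτ : a ≤ τ) (hs : 0 < s) (hs' : s < 1 / τ)
    (hX0 : 0 ≤ X) (hX : X < (2 * τ * r * min s (1 / τ - s)) ^ 2)
    (hk : k ^ 2 ≤ X * (a ^ 2 - 1)) :
    0 ≤ a * s - k ∧ a * s - k ≤ 1 ∧ X - s ^ 2 + (a * s - k) ^ 2 < 1 := by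
  have hτ : 0 < τ := by linarith
  obtain ⟨l, hl⟩ : ∃ l, l = 2 * τ * min s (1 / τ - s) := ⟨_, rfl⟩
  have hl0 : 0 < l := by
    rw [hl]; exact mul_pos (by positivity) (lt_min hs (by linarith))
  obtain ⟨Y, rfl⟩ : ∃ Y, X = l ^ 2 * Y := ⟨X / l ^ 2, by field_simp⟩
  obtain ⟨K, rfl⟩ : ∃ K, k = l * K := ⟨k / l, by field_simp⟩
  have hl2 : 0 < l ^ 2 := by positivity
  have hY0 : 0 ≤ Y := nonneg_of_mul_nonneg_right hX0 hl2
  have hY : Y < r ^ 2 := by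
    refine lt_of_mul_lt_mul_left (a := l ^ 2) (hX.trans_eq ?_) hl2.le
    rw [hl]; ring
  have hK : K ^ 2 ≤ Y * (a ^ 2 - 1) := by
    refine le_of_mul_le_mul_left (a := l ^ 2) ?_ hl2
    linarith [mul_pow l K 2]
  obtain ⟨h0, h1, h2⟩ := base_estimates hw hwτ hr hrw ha haτ hY hY0 hK
  have hpsd := tangential_nonneg (t := 1 / (2 * τ)) (k := -K) ha hY0 (by simpa using hK)
  obtain ⟨σ, hσ⟩ : ∃ σ, σ = 1 / (2 * τ) := ⟨_, rfl⟩
  have hσ0 : 0 < σ := by rw [hσ]; positivity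
  have hστ : σ * τ = 1 / 2 := by rw [hσ]; field_simp
  have haσ : a / (2 * τ) = a * σ := by rw [hσ]; ring
  have hτσ : 1 / τ = 2 * σ := by rw [hσ]; field_simp
  rw [← hσ] at hpsd h2
  rw [haσ] at h0 h1 h2
  rw [hτσ] at hl hs'
  have haσ1 : a * σ ≤ 1 / 2 := by
    rw [← hστ, mul_comm σ τ]; exact mul_le_mul_of_nonneg_right haτ hσ0.le
  have haσ0 : 0 < a * σ := by positivity
  rcases le_total s (2 * σ - s) with h | h
  · rw [min_eq_left h] at hl
    have hsl : s = l * σ := by rw [hl]; linear_combination (-2 * s) * hστ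
    have hl1 : l ≤ 1 := by
      refine le_of_mul_le_mul_right (a := σ) ?_ hσ0
      linarith
    subst hsl
    have e1 : a * (l * σ) - l * K = l * (a * σ - K) := by ring
    rw [e1]
    refine ⟨by positivity, mul_le_one₀ hl1 h0 h1, ?_⟩
    have e2 : l ^ 2 * Y - (l * σ) ^ 2 + (l * (a * σ - K)) ^ 2 =
      l ^ 2 * (Y - σ ^ 2 + (a * σ - K) ^ 2) := by ring
    rw [e2]
    exact (mul_lt_mul_of_pos_left h2 hl2).trans_le (by nlinarith)
  · rw [min_eq_right h] at hl
    have hsl : s = (2 - l) * σ := by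
      rw [hl]; linear_combination (2 * (2 * σ - s)) * hστ
    have hl1 : l ≤ 1 := by
      refine le_of_mul_le_mul_right (a := σ) ?_ hσ0
      linarith
    subst hsl
    have e1 : a * ((2 - l) * σ) - l * K = (1 - l) * (2 * (a * σ)) + l * (a * σ - K) := by ring
    rw [e1]
    have hl1' : 0 ≤ 1 - l := by linarith
    have h1' : (1 - l) * (2 * (a * σ)) ≤ 1 - l := mul_le_of_le_one_right hl1' (by linarith)
    have h1'' : l * (a * σ - K) ≤ l := mul_le_of_le_one_right hl0.le h1
    refine ⟨by positivity, by linarith, ?_⟩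
    have e2 : l ^ 2 * Y - ((2 - l) * σ) ^ 2 + ((1 - l) * (2 * (a * σ)) + l * (a * σ - K)) ^ 2 =
      (1 - l) * (4 * (a * σ) ^ 2 - 4 * σ ^ 2) + l * (Y - σ ^ 2 + (a * σ - K) ^ 2)
        - l * (1 - l) * (Y - σ ^ 2 + (a * σ - -K) ^ 2) := by ring
    rw [e2]
    have t1 : 4 * (a * σ) ^ 2 - 4 * σ ^ 2 ≤ 1 := by
      have := pow_le_pow_left₀ haσ0.le haσ1 2
      linarith [sq_nonneg σ]
    have t2 := mul_nonneg (mul_nonneg hl0.le hl1') hpsd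
    linarith [mul_le_mul_of_nonneg_left t1 hl1', mul_lt_mul_of_pos_left h2 hl0]

/-- The volume of a Euclidean ball, with the ball described by coordinates in `Fin n → ℝ`. -/
lemma volume_sum_sq_lt (n : ℕ) {R : ℝ} (hR : 0 < R) :
    volume {x : Fin n → ℝ | ∑ i, x i ^ 2 < R ^ 2} =
      ENNReal.ofReal (unitBallVolume n * R ^ n) := by
  have hs : MeasurableSet {x : Fin n → ℝ | ∑ i, x i ^ 2 < R ^ 2} :=
    (isOpen_lt (by fun_prop) (by fun_prop)).measurableSet
  have h' := (EuclideanSpace.volume_preserving_symm_measurableEquiv_toLp (Fin n)).measure_preimage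
    hs.nullMeasurableSet
  rw [← h']
  have hball : (MeasurableEquiv.toLp 2 (Fin n → ℝ)).symm ⁻¹'
      {x : Fin n → ℝ | ∑ i, x i ^ 2 < R ^ 2} =
      Metric.ball (0 : EuclideanSpace ℝ (Fin n)) R := by
    ext x
    rw [mem_ball_zero_iff, EuclideanSpace.norm_eq, Real.sqrt_lt' hR]
    simp
  rw [hball, Measure.addHaar_ball_of_pos _ _ hR, finrank_euclideanSpace_fin,
    mul_comm, unitBallVolume, ENNReal.ofReal_mul ENNReal.toReal_nonneg,
    ENNReal.ofReal_toReal measure_ball_lt_top.ne]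

/-- The integral of the `n`-th power of the tent function on `[-b, 0]`. -/
lemma integral_tent_pow (n : ℕ) {b : ℝ} (hb : 0 < b) :
    ∫ t in (-b)..0, (min (-t) (b + t)) ^ n = 2 * (b / 2) ^ (n + 1) / (n + 1) := by
  have hc : Continuous fun t : ℝ => (min (-t) (b + t)) ^ n := by fun_prop
  rw [← intervalIntegral.integral_add_adjacent_intervals
    (hc.intervalIntegrable (-b) (-(b / 2))) (hc.intervalIntegrable (-(b / 2)) 0)]
  have h1 : ∫ t in (-b)..(-(b / 2)), (min (-t) (b + t)) ^ n =
      ∫ t in (-b)..(-(b / 2)), (b + t) ^ n := by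
    refine intervalIntegral.integral_congr fun t ht => ?_
    rw [Set.uIcc_of_le (by linarith)] at ht
    rw [min_eq_right (by linarith [ht.2])]
  have h2 : ∫ t in (-(b / 2))..0, (min (-t) (b + t)) ^ n =
      ∫ t in (-(b / 2))..0, (-t) ^ n := by
    refine intervalIntegral.integral_congr fun t ht => ?_
    rw [Set.uIcc_of_le (by linarith)] at ht
    rw [min_eq_left (by linarith [ht.1])]
  rw [h1, h2, intervalIntegral.integral_comp_add_left (fun t => t ^ n),
    intervalIntegral.integral_comp_neg (fun t => t ^ n), integral_pow, integral_pow]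
  have : b + -(b / 2) = b / 2 := by ring
  rw [this]
  simp
  ring

/-- The volume of the double cone with tips `0` and `(-b, 0)` and radius `c * b / 2`. -/
lemma volume_double_cone (n : ℕ) {b c : ℝ} (hb : 0 < b) (hc : 0 < c) :
    volume {p : Fin (n + 1) → ℝ | p 0 ∈ Set.Ioo (-b) 0 ∧
      ∑ i : Fin n, p i.succ ^ 2 < (c * min (-p 0) (b + p 0)) ^ 2} =
      ENNReal.ofReal (unitBallVolume n * (b * (c * b / 2) ^ n / (n + 1))) := by
  let D : Set (ℝ × (Fin n → ℝ)) := {z | z.1 ∈ Set.Ioo (-b) 0 ∧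
    ∑ i, z.2 i ^ 2 < (c * min (-z.1) (b + z.1)) ^ 2}
  have hD : MeasurableSet D := by
    have h1 : IsOpen {z : ℝ × (Fin n → ℝ) | z.1 ∈ Set.Ioo (-b) 0} :=
      isOpen_Ioo.preimage continuous_fst
    have h2 : IsOpen {z : ℝ × (Fin n → ℝ) |
        ∑ i, z.2 i ^ 2 < (c * min (-z.1) (b + z.1)) ^ 2} :=
      isOpen_lt (by fun_prop) (by fun_prop)
    exact (h1.inter h2).measurableSet
  have hpre := (volume_preserving_piFinSuccAbove (fun _ : Fin (n + 1) => ℝ) 0).measure_preimage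
    hD.nullMeasurableSet
  have hset : {p : Fin (n + 1) → ℝ | p 0 ∈ Set.Ioo (-b) 0 ∧
      ∑ i : Fin n, p i.succ ^ 2 < (c * min (-p 0) (b + p 0)) ^ 2} =
      MeasurableEquiv.piFinSuccAbove (fun _ : Fin (n + 1) => ℝ) 0 ⁻¹' D := by
    ext p
    simp [D, MeasurableEquiv.piFinSuccAbove, Fin.tail]
  rw [hset, hpre, Measure.volume_eq_prod, Measure.prod_apply hD]
  have hslice : ∀ t : ℝ, volume (Prod.mk t ⁻¹' D) = (Set.Ioo (-b) 0).indicator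
      (fun t => ENNReal.ofReal (unitBallVolume n * (c * min (-t) (b + t)) ^ n)) t := by
    intro t
    by_cases ht : t ∈ Set.Ioo (-b) 0
    · rw [Set.indicator_of_mem ht, ← volume_sum_sq_lt n
        (mul_pos hc (lt_min (by linarith [ht.2]) (by linarith [ht.1])))]
      congr 1
      ext x
      exact and_iff_right ht
    · rw [Set.indicator_of_notMem ht]
      have : Prod.mk t ⁻¹' D = ∅ := by
        ext x
        exact iff_of_false (fun h => ht h.1) (Set.notMem_empty x)
      rw [this, measure_empty]
  simp_rw [hslice]
  rw [lintegral_indicator measurableSet_Ioo, ← ofReal_integral_eq_lintegral_ofReal]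
  · congr 1
    rw [← integral_Ioc_eq_integral_Ioo, ← intervalIntegral.integral_of_le (by linarith)]
    simp_rw [mul_pow]
    rw [intervalIntegral.integral_const_mul, intervalIntegral.integral_const_mul,
      integral_tent_pow n hb]
    rw [mul_div_assoc c b 2, mul_pow]
    ring
  · have h : Continuous fun t : ℝ => unitBallVolume n * (c * min (-t) (b + t)) ^ n := by fun_prop
    exact (h.integrableOn_Icc).mono_set Set.Ioo_subset_Icc_self
  · refine (ae_restrict_mem measurableSet_Ioo).mono fun t ht => ?_
    have : 0 ≤ min (-t) (b + t) := le_min (by linarith [ht.2]) (by linarith [ht.1])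
    have : 0 ≤ unitBallVolume n := ENNReal.toReal_nonneg
    simp only [Pi.zero_apply]
    positivity

theorem volume_inter_slabs_lower_bound (n : ℕ) (hn : 1 ≤ n) (τ : ℝ) (hτ : 1 ≤ τ)
    (S : Set (Fin (n + 1) → ℝ)) (hS : S.Nonempty)
    (hunit : ∀ ν ∈ S, minkowski ν ν = -1)
    (hpast : ∀ ν ∈ S, ν 0 < 0)
    (hslope : ∀ ν ∈ S, -ν 0 ≤ τ) :
    ENNReal.ofReal (unitBallVolume n /
        ((n + 1) * τ * (τ + Real.sqrt (τ ^ 2 - 1)) ^ n)) ≤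
      volume (⋂ ν ∈ S, {p : Fin (n + 1) → ℝ |
        minkowski p p + (minkowski p ν) ^ 2 < 1 ∧
          -1 ≤ minkowski p ν ∧ minkowski p ν ≤ 0}) := by
  have hτ0 : 0 < τ := by linarith
  have hw := Real.sqrt_nonneg (τ ^ 2 - 1)
  have hwτ : Real.sqrt (τ ^ 2 - 1) ^ 2 = τ ^ 2 - 1 := Real.sq_sqrt (by nlinarith)
  generalize Real.sqrt (τ ^ 2 - 1) = w at *
  have hτw : 0 < τ + w := by positivity
  obtain ⟨r, hr⟩ : ∃ r, r = 1 / (τ + w) := ⟨_, rfl⟩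
  have hr0 : 0 < r := by rw [hr]; positivity
  have hrw : r * (τ + w) = 1 := by rw [hr]; field_simp
  have hvol := volume_double_cone n (b := 1 / τ) (c := 2 * τ * r) (by positivity) (by positivity)
  have hval : unitBallVolume n * (1 / τ * (2 * τ * r * (1 / τ) / 2) ^ n / (n + 1)) =
      unitBallVolume n / ((n + 1) * τ * (τ + w) ^ n) := by
    have : 2 * τ * r * (1 / τ) / 2 = r := by field_simp
    rw [this, hr, one_div_pow]
    field_simp
  rw [← hval, ← hvol]
  refine measure_mono fun p hp => Set.mem_iInter₂.2 fun ν hν => ?_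
  obtain ⟨⟨hp1, hp2⟩, hp3⟩ := hp
  have hu := hunit ν hν
  have h0 := hpast ν hν
  have hsl := hslope ν hν
  rw [minkowski_eq] at hu
  have hνν : ∑ i : Fin n, ν i.succ ^ 2 = (-ν 0) ^ 2 - 1 := by
    simp_rw [pow_two]; linarith
  have hν0 : 0 ≤ ∑ i : Fin n, ν i.succ ^ 2 := by positivity
  have ha : 1 ≤ -ν 0 := by nlinarith
  have hcs := Finset.sum_mul_sq_le_sq_mul_sq Finset.univ
    (fun i : Fin n => p i.succ) (fun i : Fin n => ν i.succ)
  rw [hνν] at hcs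
  have hp3' : ∑ i : Fin n, p i.succ ^ 2 < (2 * τ * r * min (-p 0) (1 / τ - -p 0)) ^ 2 := by
    rwa [sub_neg_eq_add]
  obtain ⟨e1, e2, e3⟩ := double_cone_estimates hw hwτ hr0 hrw ha hsl (by linarith)
    (by linarith) (by positivity) hp3' hcs
  have hpp : minkowski p p = ∑ i : Fin n, p i.succ ^ 2 - (-p 0) ^ 2 := by
    rw [minkowski_eq]; simp_rw [pow_two]; ring
  rw [Set.mem_ofPred_eq, hpp, minkowski_eq p ν]
  refine ⟨?_, by linarith, by linarith⟩
  convert e3 using 2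
  ring
end

section
/- Let n ≥ 1 and τ ≥ 1, and let S be a nonempty set of past-directed unit timelike vectors ν ∈ ℝ^{n+1} (η(ν,ν) = −1, ν₀ < 0) satisfying −ν₀ ≤ τ. For each ν ∈ S define Λ(ν) = {p ∈ ℝ^{n+1} : η(p,p) + η(p,ν)² < 1/4 and −1/2 ≤ η(p,ν) ≤ 1/2}. Then the Lebesgue measure of ∩_{ν ∈ S} Λ(ν) is at least 2^{−n} ω_n / ((n+1) · τ · (τ + √(τ²−1))ⁿ). -/
open MeasureTheory

/-- The Minkowski product splits into its time part and the Euclidean product of the space parts. -/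
lemma minkowski_eq_inner {n : ℕ} (p q : Fin (n + 1) → ℝ) :
    minkowski p q = -(p 0 * q 0) +
      inner ℝ (WithLp.toLp 2 (Fin.tail p) : EuclideanSpace ℝ (Fin n)) (WithLp.toLp 2 (Fin.tail q)) := by
  simp [minkowski, Fin.sum_univ_succ, Fin.succ_ne_zero, PiLp.inner_apply, Fin.tail, mul_comm]

/-- The open double cone `a|t| + b|x| < 1` in `ℝ × ℝⁿ`. -/
def doubleCone (n : ℕ) (a b : ℝ) : Set (Fin (n + 1) → ℝ) :=
  {p | a * |p 0| + b * ‖(WithLp.toLp 2 (Fin.tail p) : EuclideanSpace ℝ (Fin n))‖ < 1}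

lemma integral_one_sub_mul_abs_pow (n : ℕ) {a : ℝ} (ha : 0 < a) :
    ∫ t in (-(1 / a))..(1 / a), (1 - a * |t|) ^ n = 2 / (a * (n + 1)) := by
  have hc : Continuous fun t : ℝ => (1 - a * |t|) ^ n := by fun_prop
  have h0 : 0 ≤ 1 / a := by positivity
  have hpos : ∫ t in (0 : ℝ)..(1 / a), (1 - a * |t|) ^ n = 1 / (a * (n + 1)) := by
    have : ∫ t in (0 : ℝ)..(1 / a), (1 - a * |t|) ^ n = ∫ t in (0 : ℝ)..(1 / a), (1 - a * t) ^ n := by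
      refine intervalIntegral.integral_congr fun t ht => ?_
      rw [Set.uIcc_of_le h0] at ht
      simp only [abs_of_nonneg ht.1]
    rw [this, intervalIntegral.integral_comp_sub_mul (fun u : ℝ => u ^ n) ha.ne' 1]
    rw [mul_one_div_cancel ha.ne']
    simp
    field_simp
  have hneg : ∫ t in (-(1 / a))..0, (1 - a * |t|) ^ n = 1 / (a * (n + 1)) := by
    rw [← hpos, ← neg_zero, ← intervalIntegral.integral_comp_neg]
    simp
  rw [← intervalIntegral.integral_add_adjacent_intervals (hc.intervalIntegrable _ _)
    (hc.intervalIntegrable _ _) (b := 0), hpos, hneg]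
  ring

lemma volume_toLp_norm_lt (n : ℕ) {r : ℝ} (hr : 0 ≤ r) (hn : 1 ≤ n) :
    volume {x : Fin n → ℝ | ‖(WithLp.toLp 2 x : EuclideanSpace ℝ (Fin n))‖ < r} =
      ENNReal.ofReal (r ^ n * unitBallVolume n) := by
  have : Nonempty (Fin n) := ⟨⟨0, hn⟩⟩
  have h := (PiLp.volume_preserving_toLp (Fin n)).measure_preimage
    (Metric.isOpen_ball (x := (0 : EuclideanSpace ℝ (Fin n))) (ε := r)).measurableSet.nullMeasurableSet
  have e : {x : Fin n → ℝ | ‖(WithLp.toLp 2 x : EuclideanSpace ℝ (Fin n))‖ < r} =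
      WithLp.toLp 2 ⁻¹' Metric.ball (0 : EuclideanSpace ℝ (Fin n)) r := by
    ext x; simp
  rw [e, h, Measure.addHaar_ball _ _ hr, ENNReal.ofReal_mul (by positivity), unitBallVolume,
    ENNReal.ofReal_toReal measure_ball_lt_top.ne, finrank_euclideanSpace_fin]

lemma le_volume_doubleCone (n : ℕ) (hn : 1 ≤ n) {a b : ℝ} (ha : 0 < a) (hb : 0 < b) :
    ENNReal.ofReal (2 * unitBallVolume n / (a * (n + 1) * b ^ n)) ≤
      volume (doubleCone n a b) := by
  have hω : 0 ≤ unitBallVolume n := ENNReal.toReal_nonneg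
  set T : Set (ℝ × (Fin n → ℝ)) :=
    {q | a * |q.1| + b * ‖(WithLp.toLp 2 q.2 : EuclideanSpace ℝ (Fin n))‖ < 1} with hT
  have hTm : MeasurableSet T := by
    refine IsOpen.measurableSet (isOpen_lt ?_ continuous_const)
    have := PiLp.continuous_toLp 2 (fun _ : Fin n => ℝ)
    fun_prop
  have hpre : doubleCone n a b =
      MeasurableEquiv.piFinSuccAbove (fun _ : Fin (n + 1) => ℝ) 0 ⁻¹' T := by
    ext p
    simp [doubleCone, hT, MeasurableEquiv.piFinSuccAbove, Fin.insertNthEquiv, Fin.removeNth_zero]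
  have hslice : ∀ t ∈ Set.Ioc (-(1 / a)) (1 / a),
      ENNReal.ofReal ((1 - a * |t|) ^ n * (unitBallVolume n / b ^ n)) =
        volume (Prod.mk t ⁻¹' T) := by
    intro t ht
    have h1 : |t| ≤ 1 / a := abs_le.2 ⟨ht.1.le, ht.2⟩
    have h2 : 0 ≤ 1 - a * |t| := by
      rw [le_div_iff₀ ha] at h1; linarith
    have e : Prod.mk t ⁻¹' T =
        {x : Fin n → ℝ | ‖(WithLp.toLp 2 x : EuclideanSpace ℝ (Fin n))‖ < (1 - a * |t|) / b} := by
      ext x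
      simp only [hT, Set.mem_preimage, Set.mem_ofPred_eq, lt_div_iff₀ hb]
      constructor <;> intro h <;> linarith
    rw [e, volume_toLp_norm_lt n (by positivity) hn, div_pow]
    congr 1
    ring
  have hle : -(1 / a) ≤ 1 / a := by
    have : 0 < 1 / a := by positivity
    linarith
  have hc : Continuous fun t : ℝ => (1 - a * |t|) ^ n * (unitBallVolume n / b ^ n) := by fun_prop
  rw [hpre, (volume_preserving_piFinSuccAbove (fun _ => ℝ) 0).measure_preimage
    hTm.nullMeasurableSet, Measure.volume_eq_prod, Measure.prod_apply hTm]
  calc _ = ENNReal.ofReal (∫ t in (-(1 / a))..(1 / a),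
          (1 - a * |t|) ^ n * (unitBallVolume n / b ^ n)) := by
        rw [intervalIntegral.integral_mul_const, integral_one_sub_mul_abs_pow n ha]
        congr 1
        field_simp
    _ = ∫⁻ t in Set.Ioc (-(1 / a)) (1 / a),
          ENNReal.ofReal ((1 - a * |t|) ^ n * (unitBallVolume n / b ^ n)) := by
        rw [intervalIntegral.integral_of_le hle]
        refine ofReal_integral_eq_lintegral_ofReal
          ((intervalIntegrable_iff_integrableOn_Ioc_of_le hle).1 (hc.intervalIntegrable _ _)) ?_
        filter_upwards [ae_restrict_mem measurableSet_Ioc] with t ht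
        have h1 : |t| ≤ 1 / a := abs_le.2 ⟨ht.1.le, ht.2⟩
        have h2 : 0 ≤ 1 - a * |t| := by
          rw [le_div_iff₀ ha] at h1; linarith
        exact mul_nonneg (pow_nonneg h2 n) (by positivity)
    _ = ∫⁻ t in Set.Ioc (-(1 / a)) (1 / a), volume (Prod.mk t ⁻¹' T) :=
        setLIntegral_congr_fun measurableSet_Ioc hslice
    _ ≤ _ := setLIntegral_le_lintegral _ _

/-- The double cone lies in the two-sided slab of every unit timelike vector of slope at most `τ`. -/
lemma doubleCone_subset_slab {n : ℕ} {τ : ℝ} (hτ : 1 ≤ τ) {ν : Fin (n + 1) → ℝ}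
    (hunit : minkowski ν ν = -1) (hpast : ν 0 < 0) (hslope : -ν 0 ≤ τ) :
    doubleCone n (2 * τ) (2 * (τ + Real.sqrt (τ ^ 2 - 1))) ⊆
      {p | minkowski p p + (minkowski p ν) ^ 2 < 1/4 ∧
          -(1/2) ≤ minkowski p ν ∧ minkowski p ν ≤ 1/2} := by
  intro p hp
  simp only [doubleCone, Set.mem_ofPred_eq] at hp
  simp only [Set.mem_ofPred_eq, minkowski_eq_inner] at hunit ⊢
  set x : EuclideanSpace ℝ (Fin n) := WithLp.toLp 2 (Fin.tail p)
  set s : EuclideanSpace ℝ (Fin n) := WithLp.toLp 2 (Fin.tail ν)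
  rw [real_inner_self_eq_norm_sq] at hunit ⊢
  have hin := abs_real_inner_le_norm x s
  set u : ℝ := inner ℝ x s
  set c : ℝ := -ν 0 with hc
  have hν : ν 0 = -c := by simp [hc]
  rw [hν] at hunit ⊢
  have hc0 : 0 ≤ c := by rw [hc]; linarith
  set σ := Real.sqrt (τ ^ 2 - 1) with hσ
  have hs0 : 0 ≤ ‖s‖ := norm_nonneg _
  have hx0 : 0 ≤ ‖x‖ := norm_nonneg _
  have ht0 : 0 ≤ |p 0| := abs_nonneg _
  have hsσ : ‖s‖ ≤ σ := Real.le_sqrt_of_sq_le (by nlinarith)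
  have hστ : σ ≤ τ := Real.sqrt_le_iff.2 ⟨by linarith, by linarith⟩
  have hσ0 : 0 ≤ σ := Real.sqrt_nonneg _
  have hm1 : c * |p 0| ≤ τ * |p 0| := by gcongr
  have hm2 : ‖s‖ * |p 0| ≤ τ * |p 0| := by gcongr; linarith
  have hm3 : c * ‖x‖ ≤ τ * ‖x‖ := by gcongr
  have hm4 : ‖s‖ * ‖x‖ ≤ σ * ‖x‖ := by gcongr
  have hm5 : 0 ≤ τ * ‖x‖ := by positivity
  have hm6 : 0 ≤ σ * ‖x‖ := by positivity
  have habs : |-(p 0 * -c) + u| ≤ 1 / 2 := by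
    calc |-(p 0 * -c) + u| ≤ |-(p 0 * -c)| + |u| := abs_add_le _ _
      _ = c * |p 0| + |u| := by rw [abs_neg, abs_mul, abs_neg, abs_of_nonneg hc0, mul_comm]
      _ ≤ 1 / 2 := by linarith
  refine ⟨?_, abs_le.1 habs⟩
  have hlt : ‖s‖ * |p 0| + c * ‖x‖ < 1 / 2 := by linarith
  have hsq : (‖s‖ * |p 0| + c * ‖x‖) ^ 2 < (1 / 2) ^ 2 := by gcongr
  have hu2 : u ^ 2 ≤ (‖x‖ * ‖s‖) ^ 2 := sq_le_sq' (abs_le.1 hin).1 (abs_le.1 hin).2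
  have hcross : p 0 * u ≤ |p 0| * (‖x‖ * ‖s‖) := by
    calc p 0 * u ≤ |p 0 * u| := le_abs_self _
      _ = |p 0| * |u| := abs_mul _ _
      _ ≤ _ := by gcongr
  have hcross' := mul_le_mul_of_nonneg_left hcross hc0
  have hS : ‖s‖ ^ 2 = c ^ 2 - 1 := by linarith
  have habs2 : |p 0| ^ 2 = p 0 ^ 2 := sq_abs _
  have e1 : (‖s‖ * |p 0| + c * ‖x‖) ^ 2 =
      (c ^ 2 - 1) * p 0 ^ 2 + 2 * (c * (|p 0| * (‖x‖ * ‖s‖))) + c ^ 2 * ‖x‖ ^ 2 := by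
    rw [← hS, ← habs2]; ring
  have e2 : (‖x‖ * ‖s‖) ^ 2 = ‖x‖ ^ 2 * (c ^ 2 - 1) := by rw [← hS]; ring
  linarith


theorem volume_inter_two_sided_slabs_lower_bound (n : ℕ) (hn : 1 ≤ n) (τ : ℝ) (hτ : 1 ≤ τ)
    (S : Set (Fin (n + 1) → ℝ)) (hS : S.Nonempty)
    (hunit : ∀ ν ∈ S, minkowski ν ν = -1)
    (hpast : ∀ ν ∈ S, ν 0 < 0)
    (hslope : ∀ ν ∈ S, -ν 0 ≤ τ) :
    ENNReal.ofReal ((2 : ℝ) ^ (-(n : ℤ)) * unitBallVolume n /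
        ((n + 1) * τ * (τ + Real.sqrt (τ ^ 2 - 1)) ^ n)) ≤
      volume (⋂ ν ∈ S, {p : Fin (n + 1) → ℝ |
        minkowski p p + (minkowski p ν) ^ 2 < 1/4 ∧
          -(1/2) ≤ minkowski p ν ∧ minkowski p ν ≤ 1/2}) := by
  have hσ : 0 ≤ Real.sqrt (τ ^ 2 - 1) := Real.sqrt_nonneg _
  have hb : 0 < 2 * (τ + Real.sqrt (τ ^ 2 - 1)) := by linarith
  have ha : 0 < 2 * τ := by linarith
  calc _ = ENNReal.ofReal (2 * unitBallVolume n /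
        (2 * τ * (n + 1) * (2 * (τ + Real.sqrt (τ ^ 2 - 1))) ^ n)) := by
        congr 1
        have : 0 < τ + Real.sqrt (τ ^ 2 - 1) := by linarith
        rw [zpow_neg, zpow_natCast, mul_pow]
        field_simp
    _ ≤ volume (doubleCone n (2 * τ) (2 * (τ + Real.sqrt (τ ^ 2 - 1)))) :=
        le_volume_doubleCone n hn ha hb
    _ ≤ _ := measure_mono <| Set.subset_iInter₂ fun ν hν =>
        doubleCone_subset_slab hτ (hunit ν hν) (hpast ν hν) (hslope ν hν)
end
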